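/- Let (Ω, 𝒜, P) be a probability space, X : Ω → 𝒳 a measurable map into a measurable space 𝒳, Y : Ω → ℝ a square-integrable random variable taking values in {0,1}, and f : 𝒳 → ℝ measurable with f(X) square-integrable. Then E[(E[Y | σ(f(X))] − f(X))²] ≤ E[(E[Y | σ(X)] − f(X))²]; that is, the squared calibration error of f is at most the squared L² distance between f(X) and the Bayes-optimal predictor f*(X) = E[Y | σ(X)]. -/

import Mathlib

open MeasureTheory

/-- The squared calibration error of `f` is at most the squared L² distance between `f(X)`
and the Bayes-optimal predictor `E[Y | σ(X)]`:
`E[(E[Y | σ(f(X))] − f(X))²] ≤ E[(E[Y | σ(X)] − f(X))²]`. -/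
theorem sq_calibration_error_le_sq_dist_to_bayes
    {Ω 𝒳 : Type*} [MeasurableSpace Ω] [MeasurableSpace 𝒳]
    (P : Measure Ω) [IsProbabilityMeasure P]
    (X : Ω → 𝒳) (hX : Measurable X)
    (Y : Ω → ℝ) (hY : Measurable Y) (hY2 : MemLp Y 2 P)
    (hY01 : ∀ ω, Y ω = 0 ∨ Y ω = 1)
    (f : 𝒳 → ℝ) (hf : Measurable f)
    (hfX2 : MemLp (fun ω => f (X ω)) 2 P) :
    ∫ ω, ((P[Y | MeasurableSpace.comap (fun ω' => f (X ω')) (borel ℝ)]) ω - f (X ω)) ^ 2 ∂P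
      ≤ ∫ ω, ((P[Y | MeasurableSpace.comap X ‹MeasurableSpace 𝒳›]) ω - f (X ω)) ^ 2 ∂P := by
  have hB : borel ℝ = (inferInstance : MeasurableSpace ℝ) := BorelSpace.measurable_eq.symm
  set m₂ : MeasurableSpace Ω := MeasurableSpace.comap X ‹MeasurableSpace 𝒳› with hm₂
  set m₁ : MeasurableSpace Ω := MeasurableSpace.comap (fun ω' => f (X ω')) (borel ℝ) with hm₁
  have h2 : m₂ ≤ _ := hX.comap_le
  have h12 : m₁ ≤ m₂ := by
    rw [hm₁, hB, hm₂]
    have h := MeasurableSpace.comap_mono (g := X) hf.comap_le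
    rwa [MeasurableSpace.comap_comp] at h
  have h1 := h12.trans h2
  have hsm : StronglyMeasurable[m₁] (fun ω => f (X ω)) := by
    apply Measurable.stronglyMeasurable
    rw [hm₁, hB]
    exact comap_measurable _
  have hfi : Integrable (fun ω => f (X ω)) P := hfX2.integrable (by norm_num)
  have hG2 : MemLp (P[Y | m₂] - fun ω => f (X ω)) 2 P :=
    (MemLp.condExp (by norm_num) hY2).sub hfX2
  have hae : P[P[Y | m₂] - (fun ω => f (X ω)) | m₁] =ᵐ[P] P[Y | m₁] - fun ω => f (X ω) := by
    refine (condExp_sub integrable_condExp hfi m₁).trans ?_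
    rw [condExp_of_stronglyMeasurable h1 hsm hfi]
    exact (condExp_condExp_of_le h12 h2).sub (Filter.EventuallyEq.refl _ _)
  have hF2 : MemLp (P[Y | m₁] - fun ω => f (X ω)) 2 P :=
    (MemLp.condExp (by norm_num) hY2).sub hfX2
  have hle := eLpNorm_condExp_le_eLpNorm (m := m₁) (μ := P)
    (P[Y | m₂] - fun ω => f (X ω)) (p := 2) (by norm_num)
  rw [eLpNorm_congr_ae hae, hF2.eLpNorm_eq_integral_rpow_norm (by norm_num) (by norm_num),
    hG2.eLpNorm_eq_integral_rpow_norm (by norm_num) (by norm_num),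
    ENNReal.ofReal_le_ofReal_iff (by positivity),
    Real.rpow_le_rpow_iff (by positivity) (by positivity) (by norm_num)] at hle
  simpa using hle
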